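/- Let Z = ([0,1] × {0}) ∪ ({0,1} × [0,1]) ⊆ [0,1] × [0,1] with the subspace topology and the partial order (s,t) ≤ (s',t') iff s ≤ s' and t = t'. There is no continuous map λ : [0,1] → Z that is monotone (with respect to the natural order on [0,1] and this order on Z) and satisfies λ(0) = (0,1) and λ(1) = (1,1). -/

import Mathlib

universe u

/-- The unit interval `I` equipped with the trivial ("discrete") partial order `Δ`. -/
def DI : Type := unitInterval

instance : TopologicalSpace DI := inferInstanceAs (TopologicalSpace unitInterval)

instance : PartialOrder DI where
  le a b := a = b
  le_refl _ := rfl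
  le_trans _ _ _ h₁ h₂ := Eq.trans h₁ h₂
  le_antisymm _ _ h _ := h

def DI.mk (t : unitInterval) : DI := t

def DI.val (t : DI) : unitInterval := t

/-- The subspace `{0,1}` of the unit interval, with the trivial partial order `Δ`. -/
def D01 : Type := {t : unitInterval // t = 0 ∨ t = 1}

instance : TopologicalSpace D01 :=
  inferInstanceAs (TopologicalSpace {t : unitInterval // t = 0 ∨ t = 1})

instance : PartialOrder D01 where
  le a b := a = b
  le_refl _ := rfl
  le_trans _ _ _ h₁ h₂ := Eq.trans h₁ h₂
  le_antisymm _ _ h _ := h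

def D01.val (t : D01) : unitInterval :=
  (show {s : unitInterval // s = 0 ∨ s = 1} from t).1

theorem snd_eq_of_monotone {p : unitInterval × DI → Prop} {lam : unitInterval → {q // p q}}
    (hm : Monotone lam) (t : unitInterval) : (lam t).1.2 = (lam 0).1.2 :=
  (hm (bot_le : (0 : unitInterval) ≤ t)).2.symm

/-- Let `Z = ([0,1] × {0}) ∪ ({0,1} × [0,1])` with the partial order
`(s,t) ≤ (s',t') ↔ s ≤ s' ∧ t = t'`. There is no continuous monotone map
`λ : [0,1] → Z` with `λ 0 = (0,1)` and `λ 1 = (1,1)`. -/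
theorem no_monotone_path :
    ¬ ∃ lam : unitInterval →
        {q : unitInterval × DI // q.2.val = 0 ∨ q.1 = 0 ∨ q.1 = 1},
      Continuous lam ∧ Monotone lam ∧
      lam 0 = ⟨((0 : unitInterval), DI.mk 1), Or.inr (Or.inl rfl)⟩ ∧
      lam 1 = ⟨((1 : unitInterval), DI.mk 1), Or.inr (Or.inr rfl)⟩ := by
  rintro ⟨lam, hc, hm, h0, h1⟩
  have hends (t : unitInterval) : (lam t).1.1 = 0 ∨ (lam t).1.1 = 1 := by
    have hsnd : (lam t).1.2.val = 1 := by
      rw [snd_eq_of_monotone hm t, h0]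
      rfl
    exact (lam t).2.resolve_left fun h => zero_ne_one (h.symm.trans hsnd)
  obtain ⟨t, ht⟩ : ∃ t, (fun t => ((lam t).1.1 : ℝ)) t = 1 / 2 := by
    apply mem_range_of_exists_le_of_exists_ge (by fun_prop)
    · exact ⟨0, by simp [h0]⟩
    · exact ⟨1, by norm_num [h1]⟩
  rcases hends t with h | h <;> norm_num [h] at ht
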